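/- arXiv:2108.07560 — 5 statements merged into one kernel-verified Lean document; each statement's English description precedes it below -/
import Mathlib

section
/- Let a, b, c be integers with 0 < a < b < c. Then in RatFunc ℚ: f_a·f_b·f_c - f_a·f_{b-a}·f_{c-a} + f_b·f_{b-a}·f_{c-b} - f_c·f_{c-a}·f_{c-b} = 0. (This is the signed sum of the Atiyah–Singer contributions of the fixed point data {+,a,b,c}, {-,a,b-a,c-a}, {+,b,b-a,c-b}, {-,c,c-a,c-b} of the weighted circle action on ℂP³ from Example 3.2; it expresses that the signature of ℂP³ computed by the index formula vanishes, and it is the identity behind Operation (2) of Theorem 1.2.) -/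
/-- The rational function `(1 + X^w)/(1 - X^w)` in `RatFunc ℚ`, for an integer
exponent `w`. -/
noncomputable def f (w : ℤ) : RatFunc ℚ :=
  (1 + RatFunc.X ^ w) / (1 - RatFunc.X ^ w)

theorem X_zpow_ne_one (n : ℤ) (hn : 0 < n) : (RatFunc.X : RatFunc ℚ) ^ n ≠ 1 := by
  obtain ⟨m, rfl⟩ := Int.eq_ofNat_of_zero_le hn.le
  intro h
  rw [zpow_natCast, ← RatFunc.algebraMap_X, ← map_pow,
    ← map_one (algebraMap (Polynomial ℚ) (RatFunc ℚ))] at h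
  have h2 := congrArg Polynomial.natDegree (RatFunc.algebraMap_injective ℚ h)
  simp at h2
  omega

theorem f_sub (a b : ℤ) : f (b - a) =
    (RatFunc.X ^ a + RatFunc.X ^ b) / (RatFunc.X ^ a - RatFunc.X ^ b) := by
  have hX : (RatFunc.X : RatFunc ℚ) ^ a ≠ 0 := zpow_ne_zero _ RatFunc.X_ne_zero
  unfold f
  rw [zpow_sub₀ RatFunc.X_ne_zero, one_add_div hX, one_sub_div hX, div_div_div_cancel_right₀ hX]

theorem X_sub_ne (a b : ℤ) (h : a < b) :
    (RatFunc.X : RatFunc ℚ) ^ a - RatFunc.X ^ b ≠ 0 := by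
  intro h0
  apply X_zpow_ne_one (b - a) (by omega)
  rw [zpow_sub₀ RatFunc.X_ne_zero, ← sub_eq_zero.1 h0,
    div_self (zpow_ne_zero _ RatFunc.X_ne_zero)]

/-- The signed sum of the Atiyah–Singer contributions of the fixed point data
`{+,a,b,c}`, `{-,a,b-a,c-a}`, `{+,b,b-a,c-b}`, `{-,c,c-a,c-b}` of the weighted circle
action on `ℂP³` (Example 3.2) vanishes; the identity behind Operation (2) of
Theorem 1.2. -/
theorem stmt6 (a b c : ℤ) (ha : 0 < a) (hab : a < b) (hbc : b < c) :
    f a * f b * f c - f a * f (b - a) * f (c - a)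
      + f b * f (b - a) * f (c - b) - f c * f (c - a) * f (c - b) = 0 := by
  rw [f_sub, f_sub, f_sub]
  have h1 := X_sub_ne a b hab
  have h2 := X_sub_ne a c (by omega)
  have h3 := X_sub_ne b c hbc
  have h4 := X_sub_ne 0 a ha
  have h5 := X_sub_ne 0 b (by omega)
  have h6 := X_sub_ne 0 c (by omega)
  rw [zpow_zero] at h4 h5 h6
  unfold f
  generalize (RatFunc.X : RatFunc ℚ) ^ a = A at *
  generalize (RatFunc.X : RatFunc ℚ) ^ b = B at *
  generalize (RatFunc.X : RatFunc ℚ) ^ c = C at *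
  field_simp
  ring
end

section
/- Let a, b, c be integers with a > b > c > 0. Then in RatFunc ℚ: f_{a-b}·f_a·f_c - f_{a-b}·f_{a-c}·f_c - f_{a-b}·f_b·f_c + f_{a-b}·f_{b-c}·f_c + f_a·f_b·f_c - f_{a-c}·f_{b-c}·f_c = 0. (This is the signed sum of the Atiyah–Singer contributions of the fixed point data {+,a-b,a,c}, {-,a-b,a-c,c}, {-,a-b,b,c}, {+,a-b,b-c,c}, {+,a,b,c}, {-,a-c,b-c,c} of the circle action on the manifold Z₁(a,b,c) of Example 3.4; it expresses that the signature of Z₁ computed by the index formula vanishes, and it is the identity behind Operation (3) of Theorem 1.2.) -/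
lemma X_zpow_ne (n : ℤ) (hn : 0 < n) : (1 - (RatFunc.X : RatFunc ℚ) ^ n) ≠ 0 := by
  lift n to ℕ using hn.le
  intro h
  rw [zpow_natCast, sub_eq_zero, ← RatFunc.algebraMap_X, ← map_pow,
    ← map_one (algebraMap (Polynomial ℚ) (RatFunc ℚ))] at h
  have h2 := congrArg Polynomial.natDegree (RatFunc.algebraMap_injective ℚ h)
  simp at h2
  omega

lemma f_add (x y : ℤ) (hx : 0 < x) (hy : 0 < y) :
    f x * f y + 1 = f (x + y) * (f x + f y) := by
  have h1 := X_zpow_ne x hx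
  have h2 := X_zpow_ne y hy
  have h3 := X_zpow_ne (x + y) (by omega)
  unfold f
  rw [zpow_add₀ RatFunc.X_ne_zero] at *
  generalize (RatFunc.X : RatFunc ℚ) ^ x = u at *
  generalize (RatFunc.X : RatFunc ℚ) ^ y = v at *
  field_simp
  ring

/-- The signed sum of the Atiyah–Singer contributions of the fixed point data
`{+,a-b,a,c}`, `{-,a-b,a-c,c}`, `{-,a-b,b,c}`, `{+,a-b,b-c,c}`, `{+,a,b,c}`,
`{-,a-c,b-c,c}` of the circle action on `Z₁(a,b,c)` (Example 3.4, `a > b > c > 0`)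
vanishes; the identity behind Operation (3) of Theorem 1.2. -/
theorem stmt7 (a b c : ℤ) (hab : a > b) (hbc : b > c) (hc : c > 0) :
    f (a - b) * f a * f c - f (a - b) * f (a - c) * f c
      - f (a - b) * f b * f c + f (a - b) * f (b - c) * f c
      + f a * f b * f c - f (a - c) * f (b - c) * f c = 0 := by
  have h1 := f_add (a - b) b (by omega) (by omega)
  have h2 := f_add (a - b) (b - c) (by omega) (by omega)
  rw [show a - b + b = a by ring] at h1
  rw [show a - b + (b - c) = a - c by ring] at h2
  linear_combination f c * (h2 - h1)
end

section
/- Let a, d be integers with 0 < 2d < a. Then in RatFunc ℚ: f_{a-d}·f_a·f_d - f_{a-d}·f_{a-2d}·f_d - 2·f_{a-d}·f_d·f_d + f_a·f_d·f_d + f_{a-2d}·f_d·f_d = 0. (This is the signed sum of the Atiyah–Singer contributions of the fixed point data {+,a-d,a,d}, {-,a-d,a-2d,d}, {-,a-d,d,d}, {-,a-d,d,d}, {+,a,d,d}, {+,a-2d,d,d} of the circle action on the manifold Z₂(a,d,d) of Example 3.6; it is the identity behind Operation (4) of Theorem 1.2.) -/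
theorem one_sub_X_zpow_ne (w : ℤ) (hw : 0 < w) : (1 : RatFunc ℚ) - RatFunc.X ^ w ≠ 0 := by
  obtain ⟨n, rfl⟩ := Int.eq_ofNat_of_zero_le hw.le
  intro h
  have h1 : (RatFunc.X : RatFunc ℚ) ^ n = 1 := by
    rw [zpow_natCast] at h
    exact (sub_eq_zero.mp h).symm
  rw [← RatFunc.algebraMap_X, ← map_pow, ← map_one (algebraMap (Polynomial ℚ) (RatFunc ℚ))] at h1
  have h2 := congrArg Polynomial.natDegree (RatFunc.algebraMap_injective ℚ h1)
  simp at h2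
  omega

/-- The signed sum of the Atiyah–Singer contributions of the fixed point data
`{+,a-d,a,d}`, `{-,a-d,a-2d,d}`, `{-,a-d,d,d}`, `{-,a-d,d,d}`, `{+,a,d,d}`,
`{+,a-2d,d,d}` of the circle action on `Z₂(a,d,d)` (Example 3.6, `0 < 2d < a`)
vanishes; the identity behind Operation (4) of Theorem 1.2. -/
theorem stmt9 (a d : ℤ) (hd : 0 < 2 * d) (hda : 2 * d < a) :
    f (a - d) * f a * f d - f (a - d) * f (a - 2 * d) * f d
      - 2 * (f (a - d) * f d * f d)
      + f a * f d * f d + f (a - 2 * d) * f d * f d = 0 := by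
  have h1 := one_sub_X_zpow_ne d (by omega)
  have h2 := one_sub_X_zpow_ne (a - 2 * d) (by omega)
  have h3 := one_sub_X_zpow_ne (a - d) (by omega)
  have h4 := one_sub_X_zpow_ne a (by omega)
  have hX : (RatFunc.X : RatFunc ℚ) ≠ 0 := RatFunc.X_ne_zero
  have e1 : (RatFunc.X : RatFunc ℚ) ^ (a - d) = RatFunc.X ^ (a - 2 * d) * RatFunc.X ^ d := by
    rw [← zpow_add₀ hX]; congr 1; ring
  have e2 : (RatFunc.X : RatFunc ℚ) ^ a
      = RatFunc.X ^ (a - 2 * d) * (RatFunc.X ^ d) ^ 2 := by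
    rw [pow_two, ← zpow_add₀ hX, ← zpow_add₀ hX]; congr 1; ring
  unfold f
  rw [e1] at h3 ⊢
  generalize hZ : (RatFunc.X : RatFunc ℚ) ^ (a - 2 * d) = Z at *
  generalize hY : (RatFunc.X : RatFunc ℚ) ^ d = Y at *
  rw [e2] at h4 ⊢
  field_simp
  ring
end

section
/- Let a, d be integers with 0 < d < a < 2d. Then in RatFunc ℚ: f_{a-d}·f_a·f_d + f_{a-d}·f_{2d-a}·f_d - 2·f_{a-d}·f_d·f_d + f_a·f_d·f_d - f_{2d-a}·f_d·f_d = 0. (This is the signed sum of the Atiyah–Singer contributions of the fixed point data {+,a-d,a,d}, {+,a-d,2d-a,d}, {-,a-d,d,d}, {-,a-d,d,d}, {+,a,d,d}, {-,2d-a,d,d} of the circle action on the manifold Z₂(a,d,d) of Example 3.7; it is the identity behind Operation (4') of Theorem 1.2.) -/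
theorem aux_ne (n : ℤ) (hn : 0 < n) : (1 : RatFunc ℚ) - RatFunc.X ^ n ≠ 0 := by
  lift n to ℕ using hn.le
  intro h
  rw [zpow_natCast, ← RatFunc.algebraMap_X, ← map_pow, ← map_one (algebraMap (Polynomial ℚ) (RatFunc ℚ)),
    ← map_sub] at h
  have h2 := (map_eq_zero_iff _ (RatFunc.algebraMap_injective ℚ)).1 h
  have h3 := congrArg (Polynomial.eval 0) h2
  have : n ≠ 0 := by omega
  simp [this] at h3

/-- The signed sum of the Atiyah–Singer contributions of the fixed point data
`{+,a-d,a,d}`, `{+,a-d,2d-a,d}`, `{-,a-d,d,d}`, `{-,a-d,d,d}`, `{+,a,d,d}`,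
`{-,2d-a,d,d}` of the circle action on `Z₂(a,d,d)` (Example 3.7, `0 < d < a < 2d`)
vanishes; the identity behind Operation (4') of Theorem 1.2. -/
theorem stmt10 (a d : ℤ) (hd : 0 < d) (hda : d < a) (had : a < 2 * d) :
    f (a - d) * f a * f d + f (a - d) * f (2 * d - a) * f d
      - 2 * (f (a - d) * f d * f d)
      + f a * f d * f d - f (2 * d - a) * f d * f d = 0 := by
  have hX : (RatFunc.X : RatFunc ℚ) ≠ 0 := RatFunc.X_ne_zero
  have h1 := aux_ne (a - d) (by omega)
  have h2 := aux_ne (2 * d - a) (by omega)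
  have h3 := aux_ne d hd
  have h4 := aux_ne a (by omega)
  have e1 : (RatFunc.X : RatFunc ℚ) ^ d = RatFunc.X ^ (a - d) * RatFunc.X ^ (2 * d - a) := by
    rw [← zpow_add₀ hX]; congr 1; ring
  have e2 : (RatFunc.X : RatFunc ℚ) ^ a
      = RatFunc.X ^ (a - d) * (RatFunc.X ^ (a - d) * RatFunc.X ^ (2 * d - a)) := by
    rw [← zpow_add₀ hX, ← zpow_add₀ hX]; congr 1; ring
  unfold f
  rw [e1] at h3 ⊢
  rw [e2] at h4 ⊢
  generalize (RatFunc.X : RatFunc ℚ) ^ (a - d) = u at *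
  generalize (RatFunc.X : RatFunc ℚ) ^ (2 * d - a) = w at *
  have h5 : 1 - u ^ 2 * w ≠ 0 := by
    intro h; apply h4; rw [← h]; ring
  field_simp
  ring
end

section
/- Let a, e be integers with 0 < 2e < a. Then in RatFunc ℚ the following signed sum of ten terms vanishes: -f_{a-e}·f_{a-2e}·f_e - f_{a-e}·f_e·f_e - f_{a-e}·f_e·f_e + f_a·f_e·f_e + f_{a-2e}·f_e·f_e - f_e·f_{a-2e}·f_{a-e} + f_e·f_{a-e}·f_{a-e} + f_e·f_{a-e}·f_{a-e} - f_a·f_{a-e}·f_{a-e} + f_{a-2e}·f_{a-e}·f_{a-e} = 0. (This is the signed sum of the Atiyah–Singer contributions of the fixed point data of the equivariant connected sum Z₂(a,e,e) ♯ Z̄₂(a,a-e,a-e) of Example 3.8, namely {-,a-e,a-2e,e}, {-,a-e,e,e}, {-,a-e,e,e}, {+,a,e,e}, {+,a-2e,e,e}, {-,e,a-2e,a-e}, {+,e,a-e,a-e}, {+,e,a-e,a-e}, {-,a,a-e,a-e}, {+,a-2e,a-e,a-e}; it is the identity behind Operation (5) of Theorem 1.2.) -/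
theorem X_zpow_ne_one_s11 (w : ℤ) (hw : 0 < w) : (1 - (RatFunc.X : RatFunc ℚ) ^ w) ≠ 0 := by
  obtain ⟨n, rfl⟩ := Int.eq_ofNat_of_zero_le hw.le
  intro h
  have h1 : (RatFunc.X : RatFunc ℚ) ^ n = 1 := by
    have := sub_eq_zero.mp h
    rw [← zpow_natCast]; exact this.symm
  have h2 : (Polynomial.X : Polynomial ℚ) ^ n = 1 := by
    apply RatFunc.algebraMap_injective ℚ
    rw [map_pow, RatFunc.algebraMap_X, h1, map_one]
  have h3 := congrArg Polynomial.natDegree h2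
  simp at h3
  omega

theorem f_add_s11 (u v : ℤ) (hu : 0 < u) (hv : 0 < v) :
    f (u + v) * (f u + f v) = 1 + f u * f v := by
  have h1 := X_zpow_ne_one_s11 u hu
  have h2 := X_zpow_ne_one_s11 v hv
  have h3 := X_zpow_ne_one_s11 (u + v) (by omega)
  unfold f
  rw [zpow_add₀ RatFunc.X_ne_zero] at h3 ⊢
  generalize (RatFunc.X : RatFunc ℚ) ^ u = x at *
  generalize (RatFunc.X : RatFunc ℚ) ^ v = y at *
  field_simp
  ring

/-- The signed sum of the Atiyah–Singer contributions of the fixed point data of the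
equivariant connected sum `Z₂(a,e,e) ♯ Z̄₂(a,a-e,a-e)` of Example 3.8, namely
`{-,a-e,a-2e,e}`, `{-,a-e,e,e}`, `{-,a-e,e,e}`, `{+,a,e,e}`, `{+,a-2e,e,e}`,
`{-,e,a-2e,a-e}`, `{+,e,a-e,a-e}`, `{+,e,a-e,a-e}`, `{-,a,a-e,a-e}`,
`{+,a-2e,a-e,a-e}`, vanishes; the identity behind Operation (5) of Theorem 1.2. -/
theorem stmt11 (a e : ℤ) (he : 0 < 2 * e) (hea : 2 * e < a) :
    -(f (a - e) * f (a - 2 * e) * f e)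
      - f (a - e) * f e * f e - f (a - e) * f e * f e
      + f a * f e * f e + f (a - 2 * e) * f e * f e
      - f e * f (a - 2 * e) * f (a - e)
      + f e * f (a - e) * f (a - e) + f e * f (a - e) * f (a - e)
      - f a * f (a - e) * f (a - e)
      + f (a - 2 * e) * f (a - e) * f (a - e) = 0 := by
  have h1 := f_add_s11 e (a - e) (by omega) (by omega)
  have h2 := f_add_s11 e (a - 2 * e) (by omega) (by omega)
  rw [show e + (a - e) = a by ring] at h1
  rw [show e + (a - 2 * e) = a - e by ring] at h2
  linear_combination (f e - f (a - e)) * h1 - (f e - f (a - e)) * h2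
end
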